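/- Let v : \R^n \to \R^n be an L-Lipschitz, bounded vector field and K \in C_c^1(\R^n) a kernel with finite weighted norm M = \int_{\R^n} |h| |\nabla K(h)| dh. If, in addition, div v = 0 (as distributions), then the commutator operator C(f) = (v\cdot\nabla)(Tf) - T((v\cdot\nabla)f), where (Tf)(x) = \int f(x+h)K(h)dh, extends to a bounded operator on C^0(\R^n) with operator norm at most L \cdot M. -/

import Mathlib

open MeasureTheory

open scoped Convolution

section Mollification

variable {E : Type*} [NormedAddCommGroup E] [InnerProductSpace ℝ E] [FiniteDimensional ℝ E]
  [MeasurableSpace E] [BorelSpace E]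

/-- A compactly supported `C¹` function admits smooth compactly supported functions whose
derivatives are uniformly close to its own, and agree with it off a fixed compact set. -/
theorem exists_smooth_dist_fderiv_le {φ : E → ℝ} (hφ : ContDiff ℝ 1 φ)
    (hφc : HasCompactSupport φ) {ε : ℝ} (hε : 0 < ε) :
    ∃ ψ : E → ℝ, ContDiff ℝ (⊤ : ℕ∞) ψ ∧ HasCompactSupport ψ ∧
      (∀ x, dist (fderiv ℝ ψ x) (fderiv ℝ φ x) ≤ ε) ∧
      ∀ x ∉ Metric.cthickening 1 (tsupport φ), fderiv ℝ ψ x = fderiv ℝ φ x := by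
  have hD : Continuous (fderiv ℝ φ) := hφ.continuous_fderiv one_ne_zero
  obtain ⟨δ, hδ, hδ'⟩ := Metric.uniformContinuous_iff.1
    ((hφc.fderiv ℝ).uniformContinuous_of_continuous hD) ε hε
  set r := min δ 1
  have hr0 : 0 < r := lt_min hδ one_pos
  let ρ : ContDiffBump (0 : E) := ⟨r / 2, r, by positivity, by linarith⟩
  have hρ : LocallyIntegrable (ρ.normed (volume : Measure E)) volume :=
    ρ.continuous_normed.locallyIntegrable
  have hfd : ∀ x, fderiv ℝ (ρ.normed volume ⋆[ContinuousLinearMap.lsmul ℝ ℝ, volume] φ) x =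
      (ρ.normed volume ⋆[ContinuousLinearMap.lsmul ℝ ℝ, volume] fderiv ℝ φ) x := fun x =>
    (hφc.hasFDerivAt_convolution_right (ContinuousLinearMap.lsmul ℝ ℝ) hρ hφ x).fderiv
  refine ⟨ρ.normed volume ⋆[ContinuousLinearMap.lsmul ℝ ℝ, volume] φ,
    ρ.hasCompactSupport_normed.contDiff_convolution_left _ ρ.contDiff_normed
      hφ.continuous.locallyIntegrable, ρ.hasCompactSupport_normed.convolution _ hφc, ?_, ?_⟩
  · intro x
    rw [hfd]
    refine ρ.dist_normed_convolution_le hD.aestronglyMeasurable fun y hy => (hδ' ?_).le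
    exact (Metric.mem_ball.1 hy).trans_le (min_le_left _ _)
  · intro x hx
    rw [hfd]
    have hzero : ∀ y ∈ Metric.ball x ρ.rOut, fderiv ℝ φ y = 0 := by
      intro y hy
      by_contra hne
      have hyt : y ∈ tsupport φ := support_fderiv_subset ℝ hne
      refine hx (Metric.mem_cthickening_of_dist_le x y 1 _ hyt ?_)
      rw [dist_comm]
      exact ((Metric.mem_ball.1 hy).trans_le (min_le_right _ _)).le
    refine dist_le_zero.1 (ρ.dist_normed_convolution_le hD.aestronglyMeasurable fun y hy => ?_)
    rw [hzero y hy, hzero x (Metric.mem_ball_self ρ.rOut_pos), dist_self]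

/-- A continuous vector field that is divergence free when tested against smooth compactly
supported functions is so against `C¹` ones. -/
theorem integral_fderiv_apply_eq_zero_of_smooth {v : E → E} (hv : Continuous v)
    (hdiv : ∀ φ : E → ℝ, ContDiff ℝ (⊤ : ℕ∞) φ → HasCompactSupport φ →
      (∫ x, fderiv ℝ φ x (v x)) = 0)
    {φ : E → ℝ} (hφ : ContDiff ℝ 1 φ) (hφc : HasCompactSupport φ) :
    (∫ x, fderiv ℝ φ x (v x)) = 0 := by
  set S := Metric.cthickening 1 (tsupport φ)
  have hSc : IsCompact S := IsCompact.cthickening hφc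
  have hint : ∀ ψ : E → ℝ, ContDiff ℝ 1 ψ → HasCompactSupport ψ →
      Integrable fun x => fderiv ℝ ψ x (v x) := by
    intro ψ hψ hψc
    refine ((hψ.continuous_fderiv one_ne_zero).clm_apply hv).integrable_of_hasCompactSupport ?_
    refine (hψc.fderiv ℝ).mono fun x hx h0 => hx ?_
    simp [h0]
  set A := ∫ x in S, ‖v x‖ with hA
  have hA0 : 0 ≤ A := integral_nonneg fun x => norm_nonneg _
  have key : ∀ ε > 0, ‖∫ x, fderiv ℝ φ x (v x)‖ ≤ ε * A := by
    intro ε hε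
    obtain ⟨ψ, hψ, hψc, hle, heq⟩ := exists_smooth_dist_fderiv_le hφ hφc hε
    have h1 : (∫ x, fderiv ℝ φ x (v x)) =
        ∫ x, (fderiv ℝ φ x (v x) - fderiv ℝ ψ x (v x)) := by
      rw [integral_sub (hint φ hφ hφc) (hint ψ (hψ.of_le (by exact_mod_cast le_top)) hψc),
        hdiv ψ hψ hψc, sub_zero]
    rw [h1, hA, ← integral_const_mul, ← integral_indicator hSc.measurableSet]
    refine norm_integral_le_of_norm_le ?_ (Filter.Eventually.of_forall fun x => ?_)
    · rw [integrable_indicator_iff hSc.measurableSet]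
      exact (continuous_const.mul hv.norm).continuousOn.integrableOn_compact hSc
    · by_cases hx : x ∈ S
      · rw [Set.indicator_of_mem hx, ← sub_apply]
        refine (ContinuousLinearMap.le_opNorm _ _).trans ?_
        gcongr
        rw [← dist_eq_norm, dist_comm]
        exact hle x
      · rw [Set.indicator_of_notMem hx, heq x hx, sub_self, norm_zero]
  refine norm_le_zero_iff.1 (le_of_forall_pos_le_add fun η hη => ?_)
  refine (key (η / (A + 1)) (by positivity)).trans ?_
  rw [zero_add, div_mul_eq_mul_div, div_le_iff₀ (by positivity)]
  nlinarith

/-- The derivative of the correlation `y ↦ ∫ f (y + h) K h` falls on the kernel. -/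
theorem fderiv_integral_add_mul_apply {f K : E → ℝ} (hf : Continuous f) (hK : ContDiff ℝ 1 K)
    (hKc : HasCompactSupport K) (x w : E) :
    fderiv ℝ (fun y => ∫ h, f (y + h) * K h) x w = -∫ h, f (x + h) * fderiv ℝ K h w := by
  set K' : E → ℝ := fun t => K (-t) with hK'
  have hK'1 : ContDiff ℝ 1 K' := hK.comp contDiff_neg
  have hK'c : HasCompactSupport K' := hKc.comp_homeomorph (Homeomorph.neg E)
  have hconv : (fun y => ∫ h, f (y + h) * K h) =
      f ⋆[ContinuousLinearMap.lsmul ℝ ℝ, volume] K' := by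
    funext y
    rw [convolution_def]
    conv_rhs => rw [← integral_add_left_eq_self _ y]
    simp [hK']
  have hderiv : ∀ t, fderiv ℝ K' t w = -fderiv ℝ K (-t) w := by
    intro t
    have := ((hK.differentiable one_ne_zero (-t)).hasFDerivAt.comp t
      (hasFDerivAt_id t).neg).fderiv
    change fderiv ℝ K' t = _ at this
    rw [this]
    simp
  rw [hconv, (hK'c.hasFDerivAt_convolution_right _ hf.locallyIntegrable hK'1 x).fderiv,
    convolution_precompR_apply _ hf.locallyIntegrable (hK'c.fderiv ℝ)
      (hK'1.continuous_fderiv one_ne_zero), convolution_def, ← integral_neg,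
    ← integral_add_left_eq_self _ x]
  simp [hderiv]

/-- Integration by parts along a divergence-free field, against a translated kernel. -/
theorem integral_fderiv_add_apply_mul {v : E → E} (hv : Continuous v)
    (hdiv : ∀ φ : E → ℝ, ContDiff ℝ (⊤ : ℕ∞) φ → HasCompactSupport φ →
      (∫ x, fderiv ℝ φ x (v x)) = 0)
    {f K : E → ℝ} (hf : ContDiff ℝ 1 f) (hK : ContDiff ℝ 1 K) (hKc : HasCompactSupport K)
    (x : E) :
    (∫ h, fderiv ℝ f (x + h) (v (x + h)) * K h) =
      -∫ h, f (x + h) * fderiv ℝ K h (v (x + h)) := by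
  have hG1 : ContDiff ℝ 1 fun y => K (y - x) := hK.comp (contDiff_id.sub contDiff_const)
  have hGc : HasCompactSupport fun y => K (y - x) :=
    hKc.comp_homeomorph (Homeomorph.subRight x)
  have h0 := integral_fderiv_apply_eq_zero_of_smooth hv hdiv (hf.mul hG1) hGc.mul_left
  rw [← integral_add_left_eq_self _ x] at h0
  have hpt : ∀ h, fderiv ℝ (f * fun y => K (y - x)) (x + h) (v (x + h)) =
      fderiv ℝ f (x + h) (v (x + h)) * K h + f (x + h) * fderiv ℝ K h (v (x + h)) := by
    intro h
    rw [fderiv_mul (hf.differentiable one_ne_zero _) (hG1.differentiable one_ne_zero _),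
      fderiv_comp_sub]
    simp
    ring
  have hvx : Continuous fun h => v (x + h) := by fun_prop
  have hfx : Continuous fun h => f (x + h) := hf.continuous.comp (by fun_prop)
  have hi1 : Integrable fun h => fderiv ℝ f (x + h) (v (x + h)) * K h := by
    refine Continuous.integrable_of_hasCompactSupport ?_ hKc.mul_left
    exact (((hf.continuous_fderiv one_ne_zero).comp (by fun_prop)).clm_apply hvx).mul
      hK.continuous
  have hi2 : Integrable fun h => f (x + h) * fderiv ℝ K h (v (x + h)) := by
    refine Continuous.integrable_of_hasCompactSupport
      (hfx.mul ((hK.continuous_fderiv one_ne_zero).clm_apply hvx)) ?_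
    refine (hKc.fderiv ℝ).mono fun h hh h0 => hh ?_
    simp [h0]
  have h1 : (∫ h, (fderiv ℝ f (x + h) (v (x + h)) * K h
      + f (x + h) * fderiv ℝ K h (v (x + h)))) = 0 := by
    rw [← h0]
    exact integral_congr_ae (Filter.Eventually.of_forall fun h => (hpt h).symm)
  rw [integral_add hi1 hi2] at h1
  exact eq_neg_of_add_eq_zero_left h1

end Mollification

/-- For a divergence-free Lipschitz vector field `v` and a kernel `K` with
`M = ∫ |h| |∇K(h)| dh < ∞`, the commutator `(v·∇)(Tf) - T((v·∇)f)` is bounded on `C^0`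
with operator norm at most `L·M`. -/
theorem commutator_bounded_on_C0 {n : ℕ}
    (v : EuclideanSpace ℝ (Fin n) → EuclideanSpace ℝ (Fin n))
    (K : EuclideanSpace ℝ (Fin n) → ℝ) (f : EuclideanSpace ℝ (Fin n) → ℝ)
    (L M N : ℝ) (hL : 0 ≤ L)
    (hv : LipschitzWith (Real.toNNReal L) v) (hvb : ∃ Cv, ∀ x, ‖v x‖ ≤ Cv)
    (hK : ContDiff ℝ 1 K) (hKc : HasCompactSupport K)
    (hM : (∫ h, ‖h‖ * ‖fderiv ℝ K h‖) = M)
    (hdiv : ∀ φ : EuclideanSpace ℝ (Fin n) → ℝ, ContDiff ℝ (⊤ : ℕ∞) φ → HasCompactSupport φ →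
      (∫ x, fderiv ℝ φ x (v x)) = 0)
    (hf : ContDiff ℝ 1 f) (hfb : ∀ x, |f x| ≤ N)
    (x : EuclideanSpace ℝ (Fin n)) :
    |fderiv ℝ (fun y => ∫ h, f (y + h) * K h) x (v x)
      - ∫ h, fderiv ℝ f (x + h) (v (x + h)) * K h| ≤ L * M * N := by
  have hN : 0 ≤ N := (abs_nonneg _).trans (hfb x)
  have hDK : Continuous (fderiv ℝ K) := hK.continuous_fderiv one_ne_zero
  have hfx : Continuous fun h => f (x + h) := hf.continuous.comp (by fun_prop)
  have hint : ∀ w : EuclideanSpace ℝ (Fin n) → EuclideanSpace ℝ (Fin n), Continuous w →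
      Integrable fun h => f (x + h) * fderiv ℝ K h (w h) := by
    intro w hw
    refine Continuous.integrable_of_hasCompactSupport (hfx.mul (hDK.clm_apply hw)) ?_
    refine (hKc.fderiv ℝ).mono fun h hh h0 => hh ?_
    simp [h0]
  have hvx : Continuous fun h => v (x + h) := hv.continuous.comp (by fun_prop)
  rw [fderiv_integral_add_mul_apply hf.continuous hK hKc,
    integral_fderiv_add_apply_mul hv.continuous hdiv hf hK hKc, neg_sub_neg,
    ← integral_sub (hint _ hvx) (hint _ continuous_const), ← hM, mul_right_comm,
    ← integral_const_mul, ← Real.norm_eq_abs]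
  refine norm_integral_le_of_norm_le ?_ (Filter.Eventually.of_forall fun h => ?_)
  · exact ((continuous_norm.mul hDK.norm).integrable_of_hasCompactSupport
      (hKc.fderiv ℝ).norm.mul_left).const_mul _
  · have hvh : ‖v (x + h) - v x‖ ≤ L * ‖h‖ := by
      simpa [Real.coe_toNNReal L hL] using hv.norm_sub_le (x + h) x
    rw [← mul_sub, ← map_sub, norm_mul, Real.norm_eq_abs]
    calc |f (x + h)| * ‖fderiv ℝ K h (v (x + h) - v x)‖
        ≤ N * (‖fderiv ℝ K h‖ * (L * ‖h‖)) := by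
          gcongr
          · exact hfb _
          · exact ((fderiv ℝ K h).le_opNorm _).trans (by gcongr)
      _ = L * N * (‖h‖ * ‖fderiv ℝ K h‖) := by ring
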